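/- As k → ∞, the ratio I(k)/L(k) converges to 0. -/

import Mathlib

/-- `K12 i = (K₁ i, K₂ i)` where `K₁ 0 = 1`, `K₂ 0 = 0`,
`K₁ (i+1) = ∑_{j=0}^{i} C(i+1, j) (K₁ j + K₂ j)` and `K₂ (i+1) = (i+1) K₁ i`. -/
def K12 : ℕ → ℕ × ℕ
  | 0 => (1, 0)
  | (i+1) =>
    ((Finset.range (i+1)).attach.sum
        (fun j => Nat.choose (i+1) j.1 * ((K12 j.1).1 + (K12 j.1).2)),
      (i+1) * (K12 i).1)
decreasing_by
  · exact Finset.mem_range.mp j.2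
  · exact Nat.lt_succ_self i

/-- `I(k) = ∑_{i=0}^{k} (K₁ i + K₂ i) C(k, i)`. -/
def Ifun (k : ℕ) : ℕ :=
  ∑ i ∈ Finset.range (k+1), ((K12 i).1 + (K12 i).2) * Nat.choose k i

/-- `J 0 = 1` and `J (i+1) = 2(i+1) J i + ∑_{t=2}^{i+1} C(i+1, t) J (i+1−t)`. -/
def Jfun : ℕ → ℕ
  | 0 => 1
  | (i+1) => 2 * (i+1) * Jfun i +
      (Finset.Icc 2 (i+1)).attach.sum (fun t => Nat.choose (i+1) t.1 * Jfun (i+1 - t.1))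
decreasing_by
  · exact Nat.lt_succ_self i
  · have := Finset.mem_Icc.mp t.2; omega

/-- `L(k) = ∑_{i=0}^{k} C(k, i) J i`. -/
def Lfun (k : ℕ) : ℕ :=
  ∑ i ∈ Finset.range (k+1), Nat.choose k i * Jfun i

open Finset Nat in
theorem sum_choose_mul_factorial_mul_two_pow_le (n : ℕ) :
    ∑ j ∈ range (n + 1), (n.choose j : ℝ) * (j ! * 2 ^ j) ≤ 5 / 3 * (n ! * 2 ^ n) := by
  have hexp : Real.exp (1 / 2) ≤ 5 / 3 := by
    have hsq : Real.exp (1 / 2) * Real.exp (1 / 2) = Real.exp 1 := by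
      rw [← Real.exp_add]; norm_num
    nlinarith [Real.exp_one_lt_d9, Real.exp_pos (1 / 2)]
  have hterm : ∀ j ∈ range (n + 1), (n.choose (n - j) : ℝ) * ((n - j)! * 2 ^ (n - j)) =
      (1 / 2 : ℝ) ^ j / j ! * (n ! * 2 ^ n) := by
    intro j hj
    have hjn : j ≤ n := Nat.lt_succ_iff.mp (mem_range.mp hj)
    have hfac : (n.choose j : ℝ) * j ! * (n - j)! = n ! := by
      exact_mod_cast Nat.choose_mul_factorial_mul_factorial hjn
    have hpow : (2 : ℝ) ^ n = 2 ^ (n - j) * 2 ^ j := by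
      rw [← pow_add, Nat.sub_add_cancel hjn]
    rw [Nat.choose_symm hjn, ← hfac, hpow, one_div, inv_pow]
    have := Nat.factorial_ne_zero j
    field_simp
  rw [← sum_flip, sum_congr rfl hterm, ← sum_mul]
  gcongr
  exact (Real.sum_le_exp_of_nonneg (by norm_num) _).trans hexp

theorem K12_succ_fst (n : ℕ) : (K12 (n + 1)).1 =
    ∑ j ∈ Finset.range (n + 1), (n + 1).choose j * ((K12 j).1 + (K12 j).2) := by
  rw [K12]
  exact Finset.sum_attach (Finset.range (n + 1))
    fun j => (n + 1).choose j * ((K12 j).1 + (K12 j).2)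

theorem K12_succ_snd (n : ℕ) : (K12 (n + 1)).2 = (n + 1) * (K12 n).1 := by
  rw [K12]

open Nat in
theorem K12_le (n : ℕ) : ((K12 n).1 : ℝ) ≤ n ! * 2 ^ n ∧
    ((K12 n).1 + (K12 n).2 : ℝ) ≤ 3 / 2 * (n ! * 2 ^ n) := by
  induction n using Nat.strong_induction_on with
  | _ n ih =>
    cases n with
    | zero => norm_num [K12]
    | succ n =>
      have hfst : ((K12 (n + 1)).1 : ℝ) ≤ (n + 1)! * 2 ^ (n + 1) := by
        have hsum := sum_choose_mul_factorial_mul_two_pow_le (n + 1)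
        rw [Finset.sum_range_succ, Nat.choose_self, Nat.cast_one, one_mul] at hsum
        calc ((K12 (n + 1)).1 : ℝ)
            = ∑ j ∈ Finset.range (n + 1),
                ((n + 1).choose j : ℝ) * ((K12 j).1 + (K12 j).2) := by
              rw [K12_succ_fst]; push_cast; rfl
          _ ≤ ∑ j ∈ Finset.range (n + 1),
                ((n + 1).choose j : ℝ) * (3 / 2 * (j ! * 2 ^ j)) := by
              refine Finset.sum_le_sum fun j hj => ?_
              gcongr
              exact (ih j (Finset.mem_range.mp hj)).2
          _ = 3 / 2 * ∑ j ∈ Finset.range (n + 1),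
                ((n + 1).choose j : ℝ) * (j ! * 2 ^ j) := by
              rw [Finset.mul_sum]
              exact Finset.sum_congr rfl fun j _ => by ring
          _ ≤ (n + 1)! * 2 ^ (n + 1) := by linarith
      have hsnd : ((K12 (n + 1)).2 : ℝ) ≤ 1 / 2 * ((n + 1)! * 2 ^ (n + 1)) := by
        have hmul := mul_le_mul_of_nonneg_left (ih n n.lt_succ_self).1
          (by positivity : (0 : ℝ) ≤ n + 1)
        rw [K12_succ_snd, Nat.factorial_succ, pow_succ]
        push_cast
        linarith
      exact ⟨hfst, by linarith⟩

open Nat in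
theorem Ifun_le (k : ℕ) : (Ifun k : ℝ) ≤ 5 / 2 * (k ! * 2 ^ k) := by
  calc (Ifun k : ℝ)
      = ∑ i ∈ Finset.range (k + 1), ((K12 i).1 + (K12 i).2 : ℝ) * k.choose i := by
        rw [Ifun]; push_cast; rfl
    _ ≤ ∑ i ∈ Finset.range (k + 1), 3 / 2 * (i ! * 2 ^ i) * (k.choose i : ℝ) := by
        gcongr with i
        exact (K12_le i).2
    _ = 3 / 2 * ∑ i ∈ Finset.range (k + 1), (k.choose i : ℝ) * (i ! * 2 ^ i) := by
        rw [Finset.mul_sum]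
        exact Finset.sum_congr rfl fun i _ => by ring
    _ ≤ 5 / 2 * (k ! * 2 ^ k) := by
        linarith [sum_choose_mul_factorial_mul_two_pow_le k]

theorem Jfun_succ (n : ℕ) : Jfun (n + 1) = 2 * (n + 1) * Jfun n +
    ∑ t ∈ Finset.Icc 2 (n + 1), (n + 1).choose t * Jfun (n + 1 - t) := by
  rw [Jfun]
  congr 1
  exact Finset.sum_attach (Finset.Icc 2 (n + 1)) fun t => (n + 1).choose t * Jfun (n + 1 - t)

theorem le_Jfun_add_two (n : ℕ) :
    2 * (n + 2) * Jfun (n + 1) + (n + 2).choose 2 * Jfun n ≤ Jfun (n + 2) := by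
  rw [Jfun_succ (n + 1)]
  have hmem : 2 ∈ Finset.Icc 2 (n + 2) := Finset.mem_Icc.mpr ⟨le_rfl, by omega⟩
  exact Nat.add_le_add_left (Finset.single_le_sum
    (f := fun t => (n + 2).choose t * Jfun (n + 2 - t)) (fun _ _ => Nat.zero_le _) hmem) _

open Nat in
theorem le_Jfun (n : ℕ) : 10 / 11 * (n ! * (11 / 5) ^ n) ≤ (Jfun n : ℝ) := by
  induction n using Nat.twoStepInduction with
  | zero => norm_num [Jfun]
  | one => norm_num [Jfun_succ 0, Jfun.eq_1]
  | more n ih₀ ih₁ =>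
    have hrec : 2 * (n + 2) * (Jfun (n + 1) : ℝ) + (n + 2) * (n + 1) / 2 * Jfun n
        ≤ Jfun (n + 2) := by
      have h : ((2 * (n + 2) * Jfun (n + 1) + (n + 2).choose 2 * Jfun n : ℕ) : ℝ)
          ≤ Jfun (n + 2) := by exact_mod_cast le_Jfun_add_two n
      push_cast [Nat.cast_choose_two] at h
      convert h using 3
      ring
    refine le_trans ?_ hrec
    have h₀ := mul_le_mul_of_nonneg_left ih₀
      (by positivity : (0 : ℝ) ≤ (n + 2) * (n + 1) / 2)
    have h₁ := mul_le_mul_of_nonneg_left ih₁ (by positivity : (0 : ℝ) ≤ 2 * (n + 2))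
    refine le_trans ?_ (add_le_add h₁ h₀)
    have hpos : (0 : ℝ) ≤ (n + 2) * (n + 1) * (n ! * (11 / 5) ^ n) := by positivity
    simp only [Nat.factorial_succ, pow_succ]
    push_cast
    linarith

theorem Jfun_le_Lfun (k : ℕ) : Jfun k ≤ Lfun k := by
  rw [Lfun, Finset.sum_range_succ, Nat.choose_self, one_mul]
  exact Nat.le_add_left _ _

/-- As `k → ∞`, the ratio `I(k)/L(k)` converges to `0`. -/
theorem stmt16 :
    Filter.Tendsto (fun k : ℕ => (Ifun k : ℝ) / (Lfun k : ℝ))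
      Filter.atTop (nhds 0) := by
  have hbound (k : ℕ) : (Ifun k : ℝ) / Lfun k ≤ 11 / 4 * (10 / 11) ^ k := by
    have hL : 10 / 11 * (k.factorial * (11 / 5) ^ k) ≤ (Lfun k : ℝ) :=
      (le_Jfun k).trans (by exact_mod_cast Jfun_le_Lfun k)
    have hpos : (0 : ℝ) < 10 / 11 * (k.factorial * (11 / 5) ^ k) := by positivity
    rw [div_le_iff₀ (hpos.trans_le hL)]
    calc (Ifun k : ℝ) ≤ 5 / 2 * (k.factorial * 2 ^ k) := Ifun_le k
      _ = 11 / 4 * (10 / 11) ^ k * (10 / 11 * (k.factorial * (11 / 5) ^ k)) := by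
        rw [show (2 : ℝ) = 10 / 11 * (11 / 5) by norm_num, mul_pow]
        ring
      _ ≤ 11 / 4 * (10 / 11) ^ k * Lfun k := by gcongr
  have hlim : Filter.Tendsto (fun k : ℕ => 11 / 4 * (10 / 11 : ℝ) ^ k)
      Filter.atTop (nhds 0) := by
    simpa using (tendsto_pow_atTop_nhds_zero_of_lt_one
      (by norm_num : (0 : ℝ) ≤ 10 / 11) (by norm_num)).const_mul (11 / 4)
  exact squeeze_zero (fun k => by positivity) hbound hlim
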